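/- arXiv:1402.4505 — 2 statements merged into one kernel-verified Lean document; each statement's English description precedes it below -/
import Mathlib

section
/- Let A be an abelian category and let S• be a bounded cochain complex (i.e., an object of the bounded derived category) with an endomorphism ψ in D(A) such that ψ induces the zero map on every cohomology object of S•. Then ψ is nilpotent: ψⁿ = 0 in D(A) for some n (in fact n can be taken to be the number of nonzero cohomology objects). -/
open CategoryTheory CategoryTheory.Limits

namespace DerivedCategory

open TStructure Pretriangulated

variable {A : Type*} [Category A] [Abelian A] [HasDerivedCategory A]

/-- On objects concentrated in degree `n`, the functor `Hⁿ` is faithful. -/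
lemma eq_zero_of_homologyFunctor_map_eq_zero_of_heart {X Y : DerivedCategory A} (n : ℤ)
    [X.IsLE n] [X.IsGE n] [Y.IsLE n] [Y.IsGE n] (f : X ⟶ Y)
    (hf : (homologyFunctor A n).map f = 0) : f = 0 := by
  obtain ⟨M, ⟨e⟩⟩ := exists_iso_singleFunctor_obj_of_isGE_of_isLE X n
  obtain ⟨N, ⟨e'⟩⟩ := exists_iso_singleFunctor_obj_of_isGE_of_isLE Y n
  obtain ⟨g, hg⟩ := (singleFunctor A n).map_surjective (e.inv ≫ f ≫ e'.hom)
  have hg' : (homologyFunctor A n).map ((singleFunctor A n).map g) = 0 := by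
    simp [hg, hf]
  have hg₀ : g = 0 := by
    have h := NatIso.naturality_1 (singleFunctorCompHomologyFunctorIso A n) g
    rw [Functor.comp_map, hg', zero_comp, comp_zero] at h
    exact h.symm
  rw [← cancel_epi e.inv, ← cancel_mono e'.hom, Category.assoc, ← hg, hg₀]
  simp

lemma epi_homologyFunctor_map_truncGEπ (X : DerivedCategory A) (n : ℤ) :
    Epi ((homologyFunctor A n).map ((t.truncGEπ n).app X)) :=
  (HomologySequence.epi_homologyMap_mor₂_iff _ (t.triangleLTGE_distinguished n X)
    n (n + 1)).2 ((isZero_of_isLE ((t.truncLT n).obj X) (n - 1) (n + 1) (by lia)).eq_of_tgt _ _)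

lemma mono_homologyFunctor_map_truncLTι (X : DerivedCategory A) (n : ℤ) :
    Mono ((homologyFunctor A n).map ((t.truncLTι (n + 1)).app X)) :=
  (HomologySequence.mono_homologyMap_mor₁_iff _ (t.triangleLTGE_distinguished (n + 1) X)
    (n - 1) n).2 ((isZero_of_isGE ((t.truncGE (n + 1)).obj X) (n + 1) (n - 1)
      (by lia)).eq_of_src _ _)

/-- A morphism from an object `≤ n` to an object `≥ n` vanishes as soon as `Hⁿ` of it does. -/
lemma eq_zero_of_homologyFunctor_map_eq_zero {X Y : DerivedCategory A} (n : ℤ)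
    [X.IsLE n] [Y.IsGE n] (f : X ⟶ Y)
    (hf : (homologyFunctor A n).map f = 0) : f = 0 := by
  obtain ⟨g, rfl⟩ : ∃ g, f = (t.truncGEπ n).app X ≫ g := ⟨_, (t.π_descTruncGE f n).symm⟩
  obtain ⟨h, rfl⟩ : ∃ h, g = h ≫ (t.truncLTι (n + 1)).app Y :=
    ⟨_, (t.liftTruncLT_ι g n (n + 1) rfl).symm⟩
  have := epi_homologyFunctor_map_truncGEπ X n
  have := mono_homologyFunctor_map_truncLTι Y n
  have hh : (homologyFunctor A n).map h = 0 := by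
    rw [← cancel_epi ((homologyFunctor A n).map ((t.truncGEπ n).app X)),
      ← cancel_mono ((homologyFunctor A n).map ((t.truncLTι (n + 1)).app Y))]
    simpa using hf
  rw [eq_zero_of_homologyFunctor_map_eq_zero_of_heart n h hh, zero_comp, comp_zero]

/-- If `S` is `≤ b` and `ψ : S ⟶ S` is zero in cohomology, then `ψ ^ k` factors through the
truncation of `S` in degrees `≤ b - k`. -/
lemma exists_pow_eq_comp_truncLTι {S : DerivedCategory A} (b : ℤ) [S.IsLE b] (ψ : End S)
    (hψ : ∀ n : ℤ, (homologyFunctor A n).map (ψ : S ⟶ S) = 0) (k : ℕ) :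
    ∃ g : S ⟶ (t.truncLT (b - k + 1)).obj S,
      ψ ^ k = g ≫ (t.truncLTι (b - k + 1)).app S := by
  induction k with
  | zero => exact ⟨t.liftTruncLT (𝟙 S) b _ (by simp), (t.liftTruncLT_ι (𝟙 S) b _ _).symm⟩
  | succ k ih =>
    obtain ⟨g, hg⟩ := ih
    generalize hm : b - (k : ℤ) = m at g hg
    have hm' : b - (k + 1 : ℕ) + 1 = m := by push_cast; lia
    rw [hm']
    have hzero : (t.truncLTι (m + 1)).app S ≫ ψ ≫ (t.truncGEπ m).app S = 0 :=
      eq_zero_of_homologyFunctor_map_eq_zero m _ (by simp [hψ])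
    obtain ⟨l, hl⟩ := Triangle.coyoneda_exact₂ _ (t.triangleLTGE_distinguished m S)
      ((t.truncLTι (m + 1)).app S ≫ ψ) ((Category.assoc _ _ _).trans hzero)
    refine ⟨g ≫ l, ?_⟩
    rw [pow_succ', End.mul_def, hg]
    exact (Category.assoc _ _ _).trans ((congrArg (g ≫ ·) hl).trans (Category.assoc _ _ _).symm)

end DerivedCategory

/-- If `S` is an object of the derived category of an abelian category with only finitely
many nonzero cohomology objects (e.g. `S` is a bounded complex), and `ψ : S ⟶ S` induces
the zero map on every cohomology object, then `ψ` is nilpotent in `End_{D(A)}(S)`. -/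
theorem nilpotent_of_zero_on_cohomology
    {A : Type*} [Category A] [Abelian A] [HasDerivedCategory A]
    (S : DerivedCategory A)
    (a b : ℤ)
    (hbounded : ∀ n : ℤ, (n < a ∨ b < n) →
      IsZero ((DerivedCategory.homologyFunctor A n).obj S))
    (ψ : S ⟶ S)
    (hψ : ∀ n : ℤ, (DerivedCategory.homologyFunctor A n).map ψ = 0) :
    IsNilpotent (R := End S) ψ := by
  have : S.IsLE b := (S.isLE_iff b).2 fun i hi ↦ hbounded i (Or.inr hi)
  have : S.IsGE a := (S.isGE_iff a).2 fun i hi ↦ hbounded i (Or.inl hi)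
  obtain ⟨g, hg⟩ := DerivedCategory.exists_pow_eq_comp_truncLTι b ψ hψ (b - a + 1).toNat
  refine ⟨_, hg.trans ?_⟩
  have : S.IsGE (b - (b - a + 1).toNat + 1) :=
    DerivedCategory.TStructure.t.isGE_of_ge S _ a (by lia)
  rw [(DerivedCategory.TStructure.t.isZero_truncLT_obj_of_isGE _ S).eq_of_tgt g 0, zero_comp]
end

section
/- Let k be a field, A a k-linear abelian category, and C•, Q• complexes with a quasi-isomorphism u : Q• → C• and a chain map φ' : Q• → C•. If the induced map on every cohomology object Hʳ(u) is an isomorphism, then the chain map φ'⊗1 − u⊗T : Q•[T] → C•[T] (where M[T] = M ⊗_k k[T] degreewise) induces an injective map on all cohomology objects Hʳ(Q•[T]) → Hʳ(C•[T]). -/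
open CategoryTheory CategoryTheory.Limits

universe v u

variable {k : Type*} [Field k]
variable {A : Type u} [Category.{v} A] [Abelian A] [CategoryTheory.Linear k A]
  [HasColimits A] [AB5 A]

/-- The complex `M•[T] = M• ⊗_k k[T]`: in each degree it is a countable coproduct of
copies of `Mⁱ` (one for each power of `T`), with differential `d ⊗ 1`. -/
noncomputable def polyComplex (C : CochainComplex A ℤ) : CochainComplex A ℤ where
  X i := ∐ (fun _ : ℕ => C.X i)
  d i j := Limits.Sigma.map (fun _ => C.d i j)
  shape i j h := by
    ext n
    simp [C.shape i j h]
  d_comp_d' i j l _ _ := by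
    ext n
    simp

/-- The chain map `φ'⊗1 − u⊗T : Q•[T] → C•[T]`, sending `Σ αᵢTⁱ` to
`Σ φ'(αᵢ)Tⁱ − Σ u(αᵢ)Tⁱ⁺¹`. -/
noncomputable def phiSubUT {Q C : CochainComplex A ℤ} (u φ' : Q ⟶ C) :
    polyComplex Q ⟶ polyComplex C where
  f i := Sigma.desc (fun n => φ'.f i ≫ Sigma.ι (fun _ : ℕ => C.X i) n -
    u.f i ≫ Sigma.ι (fun _ : ℕ => C.X i) (n + 1))
  comm' i j hij := by
    dsimp only [polyComplex]
    ext n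
    simp [polyComplex, Preadditive.sub_comp, Preadditive.comp_sub,
      HomologicalComplex.Hom.comm, HomologicalComplex.Hom.comm_assoc]

/-- The functor `X ↦ X[T]`, sending an object to the coproduct of countably many copies of it. -/
noncomputable def polyFunctor : A ⥤ A where
  obj X := ∐ (fun _ : ℕ => X)
  map f := Limits.Sigma.map (fun _ => f)

/-- The inclusion `X ⟶ X[T]` of the coefficient of `Tⁿ`, as a natural transformation. -/
noncomputable def polyMonomial (n : ℕ) : 𝟭 A ⟶ polyFunctor (A := A) where
  app X := Sigma.ι (fun _ : ℕ => X) n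
  naturality X Y f := by simp [polyFunctor]

lemma hasExactColimitsOfShape_discrete_nat : HasExactColimitsOfShape (Discrete ℕ) A := by
  have : HasFiniteBiproducts A := Abelian.hasFiniteBiproducts
  have : HasExactColimitsOfShape (Discrete (ULift.{v} ℕ)) A := (AB4.of_AB5 A).ofShape _
  exact HasExactColimitsOfShape.of_domain_equivalence A (Discrete.equivalence Equiv.ulift)

/-- The functor `X ↦ X[T]` is the colimit of constant diagrams indexed by `ℕ`. -/
noncomputable def polyFunctorIso :
    Functor.const (Discrete ℕ) ⋙ colim ≅ polyFunctor (A := A) :=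
  NatIso.ofComponents
    (fun X => HasColimit.isoOfNatIso (Discrete.natIso (fun _ => Iso.refl X)))
    (fun {X Y} f => by
      apply colimit.hom_ext
      intro j
      simp [polyFunctor]
      exact (Sigma.ι_map (fun _ : ℕ => f) j.as).symm)

instance : PreservesFiniteLimits (polyFunctor (A := A)) := by
  have := hasExactColimitsOfShape_discrete_nat (A := A)
  have : PreservesFiniteLimits (Functor.const (Discrete ℕ) (C := A)) := ⟨fun _ _ _ => inferInstance⟩
  have := comp_preservesFiniteLimits (Functor.const (Discrete ℕ) (C := A)) colim
  exact preservesFiniteLimits_of_natIso polyFunctorIso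

instance : PreservesFiniteColimits (polyFunctor (A := A)) := by
  have : PreservesFiniteColimits (Functor.const (Discrete ℕ) (C := A)) :=
    ⟨fun _ _ _ => inferInstance⟩
  have := comp_preservesFiniteColimits (Functor.const (Discrete ℕ) (C := A)) colim
  exact preservesFiniteColimits_of_natIso polyFunctorIso

instance : (polyFunctor (A := A)).PreservesZeroMorphisms where
  map_zero X Y := by
    change Limits.Sigma.map (fun _ : ℕ => (0 : X ⟶ Y)) = 0
    ext n
    simp

/-- The inclusion `C• ⟶ C•[T]` of the coefficient of `Tⁿ`. -/
noncomputable def polyComplexι (C : CochainComplex A ℤ) (n : ℕ) : C ⟶ polyComplex C where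
  f i := Sigma.ι (fun _ : ℕ => C.X i) n
  comm' i j _ := by simp [polyComplex]

/-- The objects `Hʳ(C•)[T]` and `Hʳ(C•[T])` are isomorphic, compatibly with the inclusions of
coefficients. -/
lemma exists_iso_homology_polyComplex (C : CochainComplex A ℤ) (r : ℤ) :
    ∃ e : (∐ fun _ : ℕ => C.homology r) ≅ (polyComplex C).homology r,
      ∀ n, Sigma.ι (fun _ : ℕ => C.homology r) n ≫ e.hom =
        HomologicalComplex.homologyMap (polyComplexι C n) r := by
  refine ⟨polyFunctor.mapIso ((C.sc r).mapHomologyIso (𝟭 A)) ≪≫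
    ((C.sc r).mapHomologyIso polyFunctor).symm, fun n => ?_⟩
  refine ((polyMonomial n).naturality_assoc ((C.sc r).mapHomologyIso (𝟭 A)).hom _).symm.trans ?_
  exact (ShortComplex.homologyMap_mapNatTrans (C.sc r) (polyMonomial (A := A) n)).symm

/-- A morphism between countable copowers of the form `f - g T` is a split monomorphism when `g` is
an isomorphism: a retraction `r` is defined by the recursion `r₀ = 0` and
`rₙ₊₁ = g⁻¹ (f rₙ - Tⁿ)`. -/
lemma mono_of_ι_comp_eq_sub {B : Type*} [Category* B] [Preadditive B]
    [HasCoproductsOfShape ℕ B] {X Y Z : B} (f g : X ⟶ Y) [IsIso g] (b : ℕ → (Y ⟶ Z))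
    (e : (∐ fun _ : ℕ => Y) ≅ Z) (he : ∀ n, Sigma.ι (fun _ : ℕ => Y) n ≫ e.hom = b n)
    (ψ : (∐ fun _ : ℕ => X) ⟶ Z)
    (hψ : ∀ n, Sigma.ι (fun _ : ℕ => X) n ≫ ψ = f ≫ b n - g ≫ b (n + 1)) : Mono ψ := by
  let ρ : ℕ → (Y ⟶ ∐ fun _ : ℕ => X) := fun n =>
    Nat.rec 0 (fun n s => inv g ≫ (f ≫ s - Sigma.ι (fun _ : ℕ => X) n)) n
  have hb (n : ℕ) : b n ≫ e.inv ≫ Sigma.desc ρ = ρ n := by simp [← he]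
  have hρ (n : ℕ) : ρ (n + 1) = inv g ≫ (f ≫ ρ n - Sigma.ι (fun _ : ℕ => X) n) := rfl
  have : ψ ≫ e.inv ≫ Sigma.desc ρ = 𝟙 _ := by
    ext n
    rw [reassoc_of% hψ n, Preadditive.sub_comp, Category.assoc, Category.assoc, hb, hb, hρ]
    simp
  exact mono_of_mono_fac this

/-- If `u : Q• → C•` is a quasi-isomorphism and `φ' : Q• → C•` is any chain map, then
`φ'⊗1 − u⊗T : Q•[T] → C•[T]` induces an injective map on all cohomology objects. -/
theorem mono_homologyMap_phiSubUT {Q C : CochainComplex A ℤ} (u φ' : Q ⟶ C)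
    (hu : QuasiIso u) (r : ℤ) :
    Mono (HomologicalComplex.homologyMap (phiSubUT u φ') r) := by
  have hι (n : ℕ) : polyComplexι Q n ≫ phiSubUT u φ' =
      φ' ≫ polyComplexι C n - u ≫ polyComplexι C (n + 1) := by
    ext i
    exact Sigma.ι_desc _ n
  obtain ⟨a, ha⟩ := exists_iso_homology_polyComplex Q r
  obtain ⟨b, hb⟩ := exists_iso_homology_polyComplex C r
  have : Mono (a.hom ≫ HomologicalComplex.homologyMap (phiSubUT u φ') r) :=
    mono_of_ι_comp_eq_sub (HomologicalComplex.homologyMap φ' r)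
      (HomologicalComplex.homologyMap u r) _ b hb _ (fun n => by
        rw [reassoc_of% ha n, ← HomologicalComplex.homologyMap_comp, hι,
          HomologicalComplex.homologyMap_sub, HomologicalComplex.homologyMap_comp,
          HomologicalComplex.homologyMap_comp])
  exact (mono_comp_iff_of_isIso a.hom _).1 this
end
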